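/- (One-step recursive feasibility.) Let T ≥ 2 and x ∈ ℝ^{n_x}, and suppose the family (Φ̃x^{t,i}, Φ̃u^{t,i}, σ_0,…,σ_{T−1}) is feasible for the tightened SLS problem at (T, x). Let Δ_A ∈ ℝ^{n_x×n_x} with ‖Δ_A‖_{∞→∞} ≤ ε_A, Δ_B ∈ ℝ^{n_x×n_u} with ‖Δ_B‖_{∞→∞} ≤ ε_B, and w ∈ ℝ^{n_x} with ‖w‖_∞ ≤ σ_w, and set x⁺ = (Â + Δ_A)x + (B̂ + Δ_B)Φ̃u^{0,0}x + w. If x⁺ ≠ 0, then there exists a family that is feasible for the tightened SLS problem at (T−1, x⁺). -/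

import Mathlib

open Matrix Finset

noncomputable section

/-- The ℓ¹ norm of a vector in `ℝⁿ`: `‖v‖₁ = ∑ i, |v i|`.
(The ℓ∞ norm is the default norm `‖·‖` on `Fin n → ℝ`.) -/
def norm1 {n : ℕ} (v : Fin n → ℝ) : ℝ := ∑ i, |v i|

/-- The operator norm `‖M‖_{∞→∞}` induced by the sup norm, i.e. the maximum
absolute row sum. -/
def opInf {n m : ℕ} (M : Matrix (Fin n) (Fin m) ℝ) : ℝ := ⨆ i, ∑ j, |M i j|

/-- Feasibility of a family `(Φ̃x^{t,i}, Φ̃u^{t,i}, σ₀, …, σ_{T−1})` for the tightened SLS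
problem at horizon `T` and initial state `ξ`:
(a) the SLS affine constraints, (b) the lumped-disturbance norm-bound constraints, and
(c) the tightened state, input, and terminal constraints. -/
structure SLSFeasible {nx nu px pu pT : ℕ}
    (Ahat : Matrix (Fin nx) (Fin nx) ℝ) (Bhat : Matrix (Fin nx) (Fin nu) ℝ)
    (εA εB σw : ℝ)
    (Fx : Matrix (Fin px) (Fin nx) ℝ) (bx : Fin px → ℝ)
    (Fu : Matrix (Fin pu) (Fin nu) ℝ) (bu : Fin pu → ℝ)
    (FT : Matrix (Fin pT) (Fin nx) ℝ) (bT : Fin pT → ℝ)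
    (T : ℕ) (ξ : Fin nx → ℝ)
    (Phix : ℕ → ℕ → Matrix (Fin nx) (Fin nx) ℝ)
    (Phiu : ℕ → ℕ → Matrix (Fin nu) (Fin nx) ℝ)
    (σ : ℕ → ℝ) : Prop where
  sigma_pos : ∀ t < T, 0 < σ t
  phix_zero : Phix 0 0 = 1
  phix_rec_zero : ∀ t < T, Phix (t + 1) 0 = σ t • (1 : Matrix (Fin nx) (Fin nx) ℝ)
  phix_rec : ∀ t < T, ∀ j, 1 ≤ j → j ≤ t + 1 →
    Phix (t + 1) j = Ahat * Phix t (j - 1) + Bhat * Phiu t (j - 1)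
  bound_zero : εA * ‖(Phix 0 0).mulVec ξ‖ + εB * ‖(Phiu 0 0).mulVec ξ‖ + σw ≤ σ 0
  bound_succ : ∀ t, 1 ≤ t → t < T →
    εA * (‖(Phix t t).mulVec ξ‖ + ∑ i ∈ Icc 1 t, opInf (Phix t (t - i))) +
      εB * (‖(Phiu t t).mulVec ξ‖ + ∑ i ∈ Icc 1 t, opInf (Phiu t (t - i))) + σw ≤ σ t
  state_tight : ∀ (i : Fin px), ∀ t < T,
    Fx i ⬝ᵥ (Phix t t).mulVec ξ +
      ∑ k ∈ Icc 1 t, norm1 ((Phix t (t - k))ᵀ.mulVec (Fx i)) ≤ bx i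
  input_tight : ∀ (i : Fin pu), ∀ t < T,
    Fu i ⬝ᵥ (Phiu t t).mulVec ξ +
      ∑ k ∈ Icc 1 t, norm1 ((Phiu t (t - k))ᵀ.mulVec (Fu i)) ≤ bu i
  terminal_tight : ∀ (i : Fin pT),
    FT i ⬝ᵥ (Phix T T).mulVec ξ +
      ∑ k ∈ Icc 1 T, norm1 ((Phix T (T - k))ᵀ.mulVec (FT i)) ≤ bT i

theorem opInf_row_le {n m : ℕ} (M : Matrix (Fin n) (Fin m) ℝ) (i : Fin n) :
    ∑ j, |M i j| ≤ opInf M :=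
  le_ciSup (f := fun i => ∑ j, |M i j|) (Set.finite_range _).bddAbove i

theorem opInf_nonneg {n m : ℕ} (M : Matrix (Fin n) (Fin m) ℝ) : 0 ≤ opInf M :=
  Real.iSup_nonneg fun _ => Finset.sum_nonneg fun _ _ => abs_nonneg _

theorem dot_le_norm1 {n : ℕ} (f e : Fin n → ℝ) : |f ⬝ᵥ e| ≤ norm1 f * ‖e‖ := by
  unfold norm1 dotProduct
  rw [Finset.sum_mul]
  refine (Finset.abs_sum_le_sum_abs _ _).trans (Finset.sum_le_sum fun i _ => ?_)
  rw [abs_mul]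
  exact mul_le_mul_of_nonneg_left (norm_le_pi_norm e i) (abs_nonneg _)

theorem norm_mulVec_le_opInf {n m : ℕ} (M : Matrix (Fin n) (Fin m) ℝ) (v : Fin m → ℝ) :
    ‖M.mulVec v‖ ≤ opInf M * ‖v‖ := by
  rw [pi_norm_le_iff_of_nonneg (mul_nonneg (opInf_nonneg M) (norm_nonneg v))]
  intro i
  exact (dot_le_norm1 (M i) v).trans
    (mul_le_mul_of_nonneg_right (opInf_row_le M i) (norm_nonneg v))

theorem sum_shift (t : ℕ) (g : ℕ → ℝ) :
    ∑ k ∈ Icc 1 (t + 1), g (t + 1 - k) = g t + ∑ k ∈ Icc 1 t, g (t - k) := by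
  have h : ∀ (s : ℕ) (f : ℕ → ℝ), ∑ k ∈ Icc 1 s, f k = ∑ k ∈ range s, f (k + 1) := by
    intro s f
    rw [Finset.range_eq_Ico, Finset.sum_Ico_add' f 0 s 1]
    rfl
  rw [h, h, Finset.sum_range_succ']
  simp only [Nat.add_sub_add_right, Nat.zero_add, Nat.add_sub_cancel]
  rw [add_comm]

/-- Norm bound for the shifted family. -/
theorem shift_norm {n m : ℕ} (P P' : ℕ → ℕ → Matrix (Fin n) (Fin m) ℝ)
    (x ξ e : Fin m → ℝ) (he : ‖e‖ ≤ 1) (t : ℕ)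
    (h1 : ∀ i < t, P' t i = P (t + 1) i)
    (h2 : (P' t t).mulVec ξ = (P (t + 1) (t + 1)).mulVec x + (P (t + 1) t).mulVec e) :
    ‖(P' t t).mulVec ξ‖ + ∑ i ∈ Icc 1 t, opInf (P' t (t - i)) ≤
      ‖(P (t + 1) (t + 1)).mulVec x‖ +
        ∑ i ∈ Icc 1 (t + 1), opInf (P (t + 1) (t + 1 - i)) := by
  rw [sum_shift t (fun j => opInf (P (t + 1) j)), h2]
  have hs : ∑ i ∈ Icc 1 t, opInf (P' t (t - i)) =
      ∑ i ∈ Icc 1 t, opInf (P (t + 1) (t - i)) := by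
    refine Finset.sum_congr rfl fun i hi => ?_
    rw [Finset.mem_Icc] at hi
    rw [h1 _ (by omega)]
  have := norm_add_le ((P (t + 1) (t + 1)).mulVec x) ((P (t + 1) t).mulVec e)
  have := norm_mulVec_le_opInf (P (t + 1) t) e
  have := mul_le_mul_of_nonneg_left he (opInf_nonneg (P (t + 1) t))
  rw [hs]
  linarith

/-- Half-space bound for the shifted family. -/
theorem shift_dot {n m : ℕ} (P P' : ℕ → ℕ → Matrix (Fin n) (Fin m) ℝ)
    (x ξ e : Fin m → ℝ) (he : ‖e‖ ≤ 1) (t : ℕ)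
    (h1 : ∀ i < t, P' t i = P (t + 1) i)
    (h2 : (P' t t).mulVec ξ = (P (t + 1) (t + 1)).mulVec x + (P (t + 1) t).mulVec e)
    (f : Fin n → ℝ) :
    f ⬝ᵥ (P' t t).mulVec ξ + ∑ k ∈ Icc 1 t, norm1 ((P' t (t - k))ᵀ.mulVec f) ≤
      f ⬝ᵥ (P (t + 1) (t + 1)).mulVec x +
        ∑ k ∈ Icc 1 (t + 1), norm1 ((P (t + 1) (t + 1 - k))ᵀ.mulVec f) := by
  rw [sum_shift t (fun j => norm1 ((P (t + 1) j)ᵀ.mulVec f)), h2, dotProduct_add]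
  have hs : ∑ k ∈ Icc 1 t, norm1 ((P' t (t - k))ᵀ.mulVec f) =
      ∑ k ∈ Icc 1 t, norm1 ((P (t + 1) (t - k))ᵀ.mulVec f) := by
    refine Finset.sum_congr rfl fun i hi => ?_
    rw [Finset.mem_Icc] at hi
    rw [h1 _ (by omega)]
  have h3 : f ⬝ᵥ (P (t + 1) t).mulVec e = ((P (t + 1) t)ᵀ.mulVec f) ⬝ᵥ e := by
    rw [dotProduct_mulVec, mulVec_transpose]
  have h4 := (le_abs_self _).trans (dot_le_norm1 ((P (t + 1) t)ᵀ.mulVec f) e)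
  have h5 : 0 ≤ norm1 ((P (t + 1) t)ᵀ.mulVec f) := Finset.sum_nonneg fun _ _ => abs_nonneg _
  have := mul_le_mul_of_nonneg_left he h5
  rw [hs, h3]
  linarith

/-- Diagonal state blocks of the shifted family. -/
def diagX {nx nu : ℕ} (A : Matrix (Fin nx) (Fin nx) ℝ) (B : Matrix (Fin nx) (Fin nu) ℝ)
    (U : ℕ → Matrix (Fin nu) (Fin nx) ℝ) : ℕ → Matrix (Fin nx) (Fin nx) ℝ
  | 0 => 1
  | t + 1 => A * diagX A B U t + B * U t

theorem statement14 (nx nu px pu pT : ℕ) (hnx : 1 ≤ nx) (hnu : 1 ≤ nu)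
    (Ahat : Matrix (Fin nx) (Fin nx) ℝ) (Bhat : Matrix (Fin nx) (Fin nu) ℝ)
    (εA εB σw : ℝ) (hεA : 0 ≤ εA) (hεB : 0 ≤ εB) (hσw : 0 < σw)
    (Fx : Matrix (Fin px) (Fin nx) ℝ) (bx : Fin px → ℝ)
    (Fu : Matrix (Fin pu) (Fin nu) ℝ) (bu : Fin pu → ℝ)
    (FT : Matrix (Fin pT) (Fin nx) ℝ) (bT : Fin pT → ℝ)
    (T : ℕ) (hT : 2 ≤ T) (x : Fin nx → ℝ)
    (Phix : ℕ → ℕ → Matrix (Fin nx) (Fin nx) ℝ)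
    (Phiu : ℕ → ℕ → Matrix (Fin nu) (Fin nx) ℝ)
    (σ : ℕ → ℝ)
    (hfeas : SLSFeasible Ahat Bhat εA εB σw Fx bx Fu bu FT bT T x Phix Phiu σ)
    (ΔA : Matrix (Fin nx) (Fin nx) ℝ) (hΔA : opInf ΔA ≤ εA)
    (ΔB : Matrix (Fin nx) (Fin nu) ℝ) (hΔB : opInf ΔB ≤ εB)
    (w : Fin nx → ℝ) (hw : ‖w‖ ≤ σw)
    (xplus : Fin nx → ℝ)
    (hxplus : xplus =
      (Ahat + ΔA).mulVec x + (Bhat + ΔB).mulVec ((Phiu 0 0).mulVec x) + w)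
    (hne : xplus ≠ 0) :
    ∃ (Phix' : ℕ → ℕ → Matrix (Fin nx) (Fin nx) ℝ)
      (Phiu' : ℕ → ℕ → Matrix (Fin nu) (Fin nx) ℝ) (σ' : ℕ → ℝ),
      SLSFeasible Ahat Bhat εA εB σw Fx bx Fu bu FT bT (T - 1) xplus Phix' Phiu' σ' := by
  obtain ⟨a, ha⟩ : ∃ a, xplus a ≠ 0 := by
    by_contra! h
    exact hne (funext h)
  have hσ0 : 0 < σ 0 := hfeas.sigma_pos 0 (by omega)
  set d : Fin nx → ℝ := ΔA.mulVec x + ΔB.mulVec ((Phiu 0 0).mulVec x) + w with hd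
  have hdn : ‖d‖ ≤ σ 0 := by
    have hb := hfeas.bound_zero
    rw [hfeas.phix_zero, one_mulVec] at hb
    have h1 := norm_add_le (ΔA.mulVec x + ΔB.mulVec ((Phiu 0 0).mulVec x)) w
    have h2 := norm_add_le (ΔA.mulVec x) (ΔB.mulVec ((Phiu 0 0).mulVec x))
    have h3 := norm_mulVec_le_opInf ΔA x
    have h4 := norm_mulVec_le_opInf ΔB ((Phiu 0 0).mulVec x)
    have h5 := mul_le_mul_of_nonneg_right hΔA (norm_nonneg x)
    have h6 := mul_le_mul_of_nonneg_right hΔB (norm_nonneg ((Phiu 0 0).mulVec x))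
    linarith
  set e : Fin nx → ℝ := (σ 0)⁻¹ • d with he'
  have he : ‖e‖ ≤ 1 := by
    rw [he', norm_smul, Real.norm_of_nonneg (inv_nonneg.2 hσ0.le), inv_mul_le_iff₀ hσ0]
    linarith
  have hσe : σ 0 • e = d := smul_inv_smul₀ hσ0.ne' d
  let v : Fin nx → ℝ := Pi.single a (xplus a)⁻¹
  have hv : v ⬝ᵥ xplus = 1 := by
    simp [v, ha]
  let U : ℕ → Matrix (Fin nu) (Fin nx) ℝ := fun t =>
    vecMulVec ((Phiu (t + 1) (t + 1)).mulVec x + (Phiu (t + 1) t).mulVec e) v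
  have hU : ∀ t, (U t).mulVec xplus =
      (Phiu (t + 1) (t + 1)).mulVec x + (Phiu (t + 1) t).mulVec e := by
    intro t
    simp only [U]
    rw [vecMulVec_mulVec, hv]
    simp
  have hX : ∀ t < T, (diagX Ahat Bhat U t).mulVec xplus =
      (Phix (t + 1) (t + 1)).mulVec x + (Phix (t + 1) t).mulVec e := by
    intro t
    induction t with
    | zero =>
      intro h
      rw [hfeas.phix_rec 0 h (0 + 1) le_rfl le_rfl, hfeas.phix_rec_zero 0 h]
      simp only [diagX, Nat.zero_add, Nat.sub_self]
      rw [hfeas.phix_zero, smul_mulVec, one_mulVec, one_mulVec, hσe, hxplus, hd]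
      simp only [add_mulVec, mul_one, mulVec_mulVec, Matrix.add_mul]
      abel
    | succ t ih =>
      intro h
      have ih := ih (by omega)
      rw [hfeas.phix_rec (t + 1) h (t + 1 + 1) (by omega) le_rfl,
        hfeas.phix_rec (t + 1) h (t + 1) (by omega) (by omega)]
      simp only [diagX, Nat.add_sub_cancel]
      rw [add_mulVec, ← mulVec_mulVec, ← mulVec_mulVec, ih, hU]
      simp only [add_mulVec, mulVec_add, mulVec_mulVec]
      abel
  let X' : ℕ → ℕ → Matrix (Fin nx) (Fin nx) ℝ := fun t i =>
    if i < t then Phix (t + 1) i else diagX Ahat Bhat U t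
  let U' : ℕ → ℕ → Matrix (Fin nu) (Fin nx) ℝ := fun t i =>
    if i < t then Phiu (t + 1) i else U t
  have hX1 : ∀ t, ∀ i < t, X' t i = Phix (t + 1) i := fun t i h => by simp only [X', if_pos h]
  have hU1 : ∀ t, ∀ i < t, U' t i = Phiu (t + 1) i := fun t i h => by simp only [U', if_pos h]
  have hXd : ∀ t, X' t t = diagX Ahat Bhat U t := fun t => by simp [X']
  have hUd : ∀ t, U' t t = U t := fun t => by simp [U']
  have hX2 : ∀ t < T, (X' t t).mulVec xplus =
      (Phix (t + 1) (t + 1)).mulVec x + (Phix (t + 1) t).mulVec e := fun t h => by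
    rw [hXd]; exact hX t h
  have hU2 : ∀ t, (U' t t).mulVec xplus =
      (Phiu (t + 1) (t + 1)).mulVec x + (Phiu (t + 1) t).mulVec e := fun t => by
    rw [hUd]; exact hU t
  have hB : ∀ t, t + 1 < T →
      εA * (‖(X' t t).mulVec xplus‖ + ∑ i ∈ Icc 1 t, opInf (X' t (t - i))) +
      εB * (‖(U' t t).mulVec xplus‖ + ∑ i ∈ Icc 1 t, opInf (U' t (t - i))) + σw
        ≤ σ (t + 1) := by
    intro t ht
    have h1 := shift_norm Phix X' x xplus e he t (hX1 t) (hX2 t (by omega))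
    have h2 := shift_norm Phiu U' x xplus e he t (hU1 t) (hU2 t)
    have h3 := hfeas.bound_succ (t + 1) (by omega) ht
    have h4 := mul_le_mul_of_nonneg_left h1 hεA
    have h5 := mul_le_mul_of_nonneg_left h2 hεB
    linarith
  refine ⟨X', U', fun t => σ (t + 1), ?_⟩
  constructor
  · exact fun t ht => hfeas.sigma_pos _ (by omega)
  · rw [hXd]; rfl
  · intro t ht
    rw [hX1 _ _ (by omega)]
    exact hfeas.phix_rec_zero (t + 1) (by omega)
  · intro t ht j hj1 hj2
    rcases Nat.lt_or_ge j (t + 1) with h | h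
    · rw [hX1 _ _ h, hX1 _ _ (by omega), hU1 _ _ (by omega)]
      exact hfeas.phix_rec (t + 1) (by omega) j hj1 (by omega)
    · obtain rfl : j = t + 1 := le_antisymm hj2 h
      rw [Nat.add_sub_cancel, hXd, hXd, hUd]
      rfl
  · simpa using hB 0 (by omega)
  · intro t _ ht
    exact hB t (by omega)
  · intro i t ht
    exact (shift_dot Phix X' x xplus e he t (hX1 t) (hX2 t (by omega)) _).trans
      (hfeas.state_tight i (t + 1) (by omega))
  · intro i t ht
    exact (shift_dot Phiu U' x xplus e he t (hU1 t) (hU2 t) _).trans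
      (hfeas.input_tight i (t + 1) (by omega))
  · intro i
    obtain ⟨S, rfl⟩ : ∃ S, T = S + 1 := ⟨T - 1, by omega⟩
    exact (shift_dot Phix X' x xplus e he S (hX1 S) (hX2 S (by omega)) _).trans
      (hfeas.terminal_tight i)
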